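/- arXiv:0711.3986 — 2 statements merged into one kernel-verified Lean document; each statement's English description precedes it below -/
import Mathlib

section
/- Künneth theorem: for any field k and any cochain complexes C, D of k-vector spaces, the map d on C ⊗ D defined by d(x ⊗ y) = d_C x ⊗ y + (−1)^p x ⊗ d_D y (x ∈ C^p) satisfies d² = 0, and for every n there is an isomorphism H^n(C ⊗ D) ≅ ⊕_{p+q=n} H^p(C) ⊗ H^q(D). -/
/-!  STATEMENT 5.
Künneth theorem for cochain complexes of vector spaces: the differential on `C ⊗ D` given on
pure tensors by `d(x ⊗ y) = d_C x ⊗ y + (-1)^p x ⊗ d_D y` (for `x` of degree `p`) squares to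
zero, and `H^n(C ⊗ D) ≅ ⊕_{p+q=n} H^p(C) ⊗ H^q(D)`. -/

noncomputable section

open scoped TensorProduct DirectSum BigOperators

namespace Kunneth

variable (k : Type) [Field k]

/-- The submodule of coboundaries in degree `n` (the image of the incoming differential,
`⊥` in degree `0`). -/
def coboundaries {E : ℕ → Type} [∀ n, AddCommGroup (E n)] [∀ n, Module k (E n)]
    (d : ∀ n, E n →ₗ[k] E (n + 1)) : ∀ n : ℕ, Submodule k (E n)
  | 0 => ⊥
  | (m + 1) => LinearMap.range (d m)

/-- The `n`-th cohomology of an `ℕ`-graded cochain complex: cocycles modulo coboundaries. -/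
abbrev Coh {E : ℕ → Type} [∀ n, AddCommGroup (E n)] [∀ n, Module k (E n)]
    (d : ∀ n, E n →ₗ[k] E (n + 1)) (n : ℕ) : Type :=
  LinearMap.ker (d n) ⧸
    (Submodule.comap (LinearMap.ker (d n)).subtype (coboundaries k d n))

/-- Index set for the degree-`n` part of a tensor product of graded objects. -/
abbrev Idx (n : ℕ) : Type := {pq : ℕ × ℕ // pq.1 + pq.2 = n}

/-- The degree-`n` part of the tensor product complex `C ⊗ D`. -/
abbrev TC (C D : ℕ → Type) [∀ p, AddCommGroup (C p)] [∀ p, Module k (C p)]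
    [∀ p, AddCommGroup (D p)] [∀ p, Module k (D p)] (n : ℕ) : Type :=
  ⨁ (s : Idx n), (C s.1.1 ⊗[k] D s.1.2)

/-- A deformation retraction of the complex `(E, d)` onto the graded module `G` with zero
differential: `π ∘ i = 1` and `1 - i ∘ π = d ∘ h + h ∘ d`. -/
structure Contraction {E : ℕ → Type} [∀ n, AddCommGroup (E n)] [∀ n, Module k (E n)]
    (d : ∀ n, E n →ₗ[k] E (n + 1)) (G : ℕ → Type) [∀ n, AddCommGroup (G n)]
    [∀ n, Module k (G n)] where
  i : ∀ n, G n →ₗ[k] E n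
  π : ∀ n, E n →ₗ[k] G n
  h : ∀ n, E (n + 1) →ₗ[k] E n
  d_i : ∀ n g, d n (i n g) = 0
  π_d : ∀ n x, π (n + 1) (d n x) = 0
  π_i : ∀ n g, π n (i n g) = g
  h_d_zero : ∀ x, h 0 (d 0 x) = x - i 0 (π 0 x)
  d_h : ∀ n x, d n (h n x) = x - i (n + 1) (π (n + 1) x) - h (n + 1) (d (n + 1) x)

section Contraction

variable {k} {E : ℕ → Type} [∀ n, AddCommGroup (E n)] [∀ n, Module k (E n)]
  {d : ∀ n, E n →ₗ[k] E (n + 1)}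

/-- The cohomology of a complex that retracts onto `G` is `G`. -/
def Contraction.cohEquiv {G : ℕ → Type} [∀ n, AddCommGroup (G n)] [∀ n, Module k (G n)]
    (c : Contraction k d G) (n : ℕ) : Coh k d n ≃ₗ[k] G n :=
  (Submodule.quotEquivOfEq _ (LinearMap.ker ((c.π n).comp (LinearMap.ker (d n)).subtype)) (by
    ext ⟨x, hx⟩
    rw [LinearMap.mem_ker] at hx
    cases n with
    | zero =>
      have := c.h_d_zero x
      rw [hx, map_zero, eq_comm, sub_eq_zero] at this
      simp only [coboundaries, Submodule.mem_comap, Submodule.subtype_apply, Submodule.mem_bot,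
        LinearMap.mem_ker, LinearMap.comp_apply]
      exact ⟨fun h0 => by rw [h0, map_zero], fun h0 => by rw [this, h0, map_zero]⟩
    | succ m =>
      simp only [coboundaries, Submodule.mem_comap, Submodule.subtype_apply,
        LinearMap.mem_range, LinearMap.mem_ker, LinearMap.comp_apply]
      constructor
      · rintro ⟨y, rfl⟩
        exact c.π_d m y
      · intro h0
        refine ⟨c.h m x, ?_⟩
        rw [c.d_h, h0, hx]
        simp)).trans
  (LinearMap.quotKerEquivOfSurjective _ fun g =>
    ⟨⟨c.i n g, c.d_i n g⟩, c.π_i n g⟩)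

/-- Every linear map of vector spaces has a generalized inverse. -/
theorem exists_generalizedInverse {V W : Type} [AddCommGroup V] [Module k V] [AddCommGroup W]
    [Module k W] (f : V →ₗ[k] W) : ∃ g : W →ₗ[k] V, ∀ x, f (g (f x)) = f x := by
  obtain ⟨g, hg⟩ := f.rangeRestrict.exists_rightInverse_of_surjective f.range_rangeRestrict
  obtain ⟨g', hg'⟩ := g.exists_extend
  refine ⟨g', fun x => ?_⟩
  have h₁ : g' (f x) = g (f.rangeRestrict x) := LinearMap.congr_fun hg' (f.rangeRestrict x)
  rw [h₁]
  exact congrArg Subtype.val (LinearMap.congr_fun hg (f.rangeRestrict x))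

variable (d) in
/-- The endomorphism `1 - d ∘ g - g ∘ d` of a complex. -/
def residue (g : ∀ n, E (n + 1) →ₗ[k] E n) : ∀ n, E n →ₗ[k] E n
  | 0 => LinearMap.id - (g 0).comp (d 0)
  | n + 1 => LinearMap.id - (d n).comp (g n) - (g (n + 1)).comp (d (n + 1))

section residue

variable {g : ∀ n, E (n + 1) →ₗ[k] E n}

theorem d_residue (hd : ∀ n, (d (n + 1)).comp (d n) = 0)
    (hg : ∀ n x, d n (g n (d n x)) = d n x) (n : ℕ) (x : E n) : d n (residue d g n x) = 0 := by
  cases n with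
  | zero => simp [residue, hg]
  | succ m =>
    have h₁ (y : E m) : d (m + 1) (d m y) = 0 := LinearMap.congr_fun (hd m) y
    simp [residue, hg, h₁]

theorem residue_d (hd : ∀ n, (d (n + 1)).comp (d n) = 0)
    (hg : ∀ n x, d n (g n (d n x)) = d n x) (n : ℕ) (x : E n) :
    residue d g (n + 1) (d n x) = 0 := by
  have := LinearMap.congr_fun (hd n) x
  simp only [LinearMap.comp_apply, LinearMap.zero_apply] at this
  simp [residue, hg, this]

theorem residue_eq_zero_of_mem_coboundaries (hd : ∀ n, (d (n + 1)).comp (d n) = 0)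
    (hg : ∀ n x, d n (g n (d n x)) = d n x) {n : ℕ} {x : E n} (hx : x ∈ coboundaries k d n) :
    residue d g n x = 0 := by
  cases n with
  | zero => rw [(Submodule.mem_bot k).1 hx, map_zero]
  | succ m =>
    obtain ⟨y, rfl⟩ := hx
    exact residue_d hd hg m y

theorem residue_sub_mem_coboundaries {n : ℕ} {x : E n} (hx : d n x = 0) :
    residue d g n x - x ∈ coboundaries k d n := by
  cases n with
  | zero => simp [residue, hx]
  | succ m => exact ⟨-g m x, by simp [residue, hx]⟩

end residue

/-- A complex of vector spaces retracts onto its cohomology. -/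
theorem nonempty_contraction_coh (hd : ∀ n, (d (n + 1)).comp (d n) = 0) :
    Nonempty (Contraction k d (Coh k d)) := by
  choose g hg using fun n => exists_generalizedInverse (d n)
  have de := d_residue hd hg
  have ed := residue_d hd hg
  let i : ∀ n, Coh k d n →ₗ[k] E n := fun n =>
    Submodule.liftQ _ ((residue d g n).comp (LinearMap.ker (d n)).subtype) fun x hx =>
      residue_eq_zero_of_mem_coboundaries hd hg hx
  let π : ∀ n, E n →ₗ[k] Coh k d n := fun n =>
    (Submodule.mkQ _).comp ((residue d g n).codRestrict (LinearMap.ker (d n)) (de n))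
  have hi : ∀ n x, i n (π n x) = residue d g n (residue d g n x) := fun n x => rfl
  refine ⟨{
    i := i
    π := π
    h := fun n => (g n).comp (LinearMap.id + residue d g (n + 1))
    d_i := ?_
    π_d := ?_
    π_i := ?_
    h_d_zero := ?_
    d_h := ?_ }⟩
  · intro n c
    obtain ⟨z, rfl⟩ := Submodule.mkQ_surjective _ c
    exact de n z
  · intro n x
    have : (residue d g (n + 1)).codRestrict (LinearMap.ker (d (n + 1))) (de (n + 1)) (d n x) = 0 :=
      Subtype.ext (ed n x)
    simp only [π, LinearMap.comp_apply, this, map_zero]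
  · intro n c
    obtain ⟨z, rfl⟩ := Submodule.mkQ_surjective _ c
    refine (Submodule.Quotient.eq _).2 ?_
    change residue d g n (residue d g n z) - z ∈ coboundaries k d n
    have h₁ := residue_sub_mem_coboundaries (g := g) (de n z)
    have h₂ := residue_sub_mem_coboundaries (g := g) z.2
    simpa using add_mem h₁ h₂
  · intro x
    rw [hi]
    have h₀ : ∀ y, residue d g 0 y = y - g 0 (d 0 y) := fun y => rfl
    have h₁ := h₀ (residue d g 0 x)
    rw [de, map_zero, sub_zero] at h₁
    simp only [LinearMap.comp_apply, LinearMap.add_apply, LinearMap.id_apply, ed, h₁, add_zero]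
    rw [h₀ x]
    abel
  · intro n x
    rw [hi]
    have h₀ : ∀ y, residue d g (n + 1) y = y - d n (g n y) - g (n + 1) (d (n + 1) y) :=
      fun y => rfl
    have h₁ := h₀ (residue d g (n + 1) x)
    rw [de, map_zero, sub_zero] at h₁
    simp only [LinearMap.comp_apply, LinearMap.add_apply, LinearMap.id_apply, map_add, ed, h₁,
      add_zero]
    rw [h₀ x]
    abel

end Contraction

section TensorProduct

variable {k} {C D : ℕ → Type}
  [∀ p, AddCommGroup (C p)] [∀ p, Module k (C p)] [∀ p, AddCommGroup (D p)] [∀ p, Module k (D p)]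

variable (C D) in
/-- The pure tensors of bidegree `(p, q)` in the tensor product complex. -/
def pureTensor {n : ℕ} (p q : ℕ) (hpq : p + q = n) : C p →ₗ[k] D q →ₗ[k] TC k C D n :=
  (TensorProduct.mk k (C p) (D q)).compr₂
    (DirectSum.lof k (Idx n) (fun s => C s.1.1 ⊗[k] D s.1.2) ⟨(p, q), hpq⟩)

/-- Linear maps out of `TC` that agree on pure tensors are equal. -/
theorem TC.hom_ext {n : ℕ} {M : Type} [AddCommGroup M] [Module k M] {f g : TC k C D n →ₗ[k] M}
    (h : ∀ p q (hpq : p + q = n) x y,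
      f (pureTensor C D p q hpq x y) = g (pureTensor C D p q hpq x y)) :
    f = g :=
  DirectSum.linearMap_ext _ fun ⟨(p, q), hpq⟩ => TensorProduct.ext' (h p q hpq)

/-- The linear map out of `TC` given by a family of bilinear maps. -/
def TC.lift {n : ℕ} {M : Type} [AddCommGroup M] [Module k M]
    (f : ∀ p q, p + q = n → C p →ₗ[k] D q →ₗ[k] M) : TC k C D n →ₗ[k] M :=
  DirectSum.toModule k (Idx n) M fun s => TensorProduct.lift (f s.1.1 s.1.2 s.2)

@[simp]
theorem TC.lift_pure {n : ℕ} {M : Type} [AddCommGroup M] [Module k M]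
    (f : ∀ p q, p + q = n → C p →ₗ[k] D q →ₗ[k] M) (p q : ℕ) (hpq : p + q = n) (x : C p)
    (y : D q) : TC.lift f (pureTensor C D p q hpq x y) = f p q hpq x y := by
  simp [TC.lift, pureTensor]

/-- The differential of the tensor product complex. -/
def tensorD (dC : ∀ p, C p →ₗ[k] C (p + 1)) (dD : ∀ p, D p →ₗ[k] D (p + 1)) (n : ℕ) :
    TC k C D n →ₗ[k] TC k C D (n + 1) :=
  TC.lift fun p q _ =>
    (pureTensor C D (p + 1) q (by omega)).comp (dC p) +
      (-1 : k) ^ p • (pureTensor C D p (q + 1) (by omega)).compl₂ (dD q)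

theorem tensorD_pure (dC : ∀ p, C p →ₗ[k] C (p + 1)) (dD : ∀ p, D p →ₗ[k] D (p + 1)) {n : ℕ}
    (p q : ℕ) (hpq : p + q = n) (x : C p) (y : D q) :
    tensorD dC dD n (pureTensor C D p q hpq x y) = pureTensor C D (p + 1) q (by omega) (dC p x) y +
      (-1 : k) ^ p • pureTensor C D p (q + 1) (by omega) x (dD q y) := by
  simp [tensorD]

theorem tensorD_comp_tensorD {dC : ∀ p, C p →ₗ[k] C (p + 1)} {dD : ∀ p, D p →ₗ[k] D (p + 1)}
    (hC : ∀ p, (dC (p + 1)).comp (dC p) = 0) (hD : ∀ p, (dD (p + 1)).comp (dD p) = 0) (n : ℕ) :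
    (tensorD dC dD (n + 1)).comp (tensorD dC dD n) = 0 := by
  refine TC.hom_ext fun p q hpq x y => ?_
  have hx : dC (p + 1) (dC p x) = 0 := LinearMap.congr_fun (hC p) x
  have hy : dD (q + 1) (dD q y) = 0 := LinearMap.congr_fun (hD q) y
  simp only [LinearMap.comp_apply, tensorD_pure, map_add, map_smul, hx, hy, map_zero,
    LinearMap.zero_apply, pow_succ]
  module

/-- The tensor product of two families of linear maps, in degree `n`. -/
def tensorMap {C' D' : ℕ → Type} [∀ p, AddCommGroup (C' p)] [∀ p, Module k (C' p)]
    [∀ p, AddCommGroup (D' p)] [∀ p, Module k (D' p)] (f : ∀ p, C p →ₗ[k] C' p)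
    (g : ∀ p, D p →ₗ[k] D' p) (n : ℕ) : TC k C D n →ₗ[k] TC k C' D' n :=
  TC.lift fun p q hpq => (pureTensor C' D' p q hpq).compl₁₂ (f p) (g q)

@[simp]
theorem tensorMap_pure {C' D' : ℕ → Type} [∀ p, AddCommGroup (C' p)] [∀ p, Module k (C' p)]
    [∀ p, AddCommGroup (D' p)] [∀ p, Module k (D' p)] (f : ∀ p, C p →ₗ[k] C' p)
    (g : ∀ p, D p →ₗ[k] D' p) {n : ℕ} (p q : ℕ) (hpq : p + q = n) (x : C p) (y : D q) :
    tensorMap f g n (pureTensor C D p q hpq x y) = pureTensor C' D' p q hpq (f p x) (g q y) := by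
  simp [tensorMap]

/-- The map `h ⊗ 1` of degree `-1`. -/
def leftHomotopy (h : ∀ p, C (p + 1) →ₗ[k] C p) (n : ℕ) : TC k C D (n + 1) →ₗ[k] TC k C D n :=
  TC.lift fun
    | 0, _, _ => 0
    | p + 1, q, _ => (pureTensor C D p q (by omega)).comp (h p)

/-- The map `e ⊗ h` of degree `-1`, with the Koszul sign. -/
def rightHomotopy (e : ∀ p, C p →ₗ[k] C p) (h : ∀ q, D (q + 1) →ₗ[k] D q) (n : ℕ) :
    TC k C D (n + 1) →ₗ[k] TC k C D n :=
  TC.lift fun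
    | _, 0, _ => 0
    | p, q + 1, _ => (-1 : k) ^ p • (pureTensor C D p q (by omega)).compl₁₂ (e p) (h q)

section homotopy

variable {n : ℕ} (e : ∀ p, C p →ₗ[k] C p) (hC : ∀ p, C (p + 1) →ₗ[k] C p)
  (hD : ∀ q, D (q + 1) →ₗ[k] D q)

theorem leftHomotopy_pure_zero (q : ℕ) (hq : 0 + q = n + 1) (x : C 0) (y : D q) :
    leftHomotopy hC n (pureTensor C D 0 q hq x y) = 0 := by
  simp [leftHomotopy]

theorem leftHomotopy_pure_succ (p q : ℕ) (hpq : p + 1 + q = n + 1) (x : C (p + 1)) (y : D q) :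
    leftHomotopy hC n (pureTensor C D (p + 1) q hpq x y) =
      pureTensor C D p q (by omega) (hC p x) y := by
  simp [leftHomotopy]

theorem rightHomotopy_pure_zero (p : ℕ) (hp : p + 0 = n + 1) (x : C p) (y : D 0) :
    rightHomotopy e hD n (pureTensor C D p 0 hp x y) = 0 := by
  simp [rightHomotopy]

theorem rightHomotopy_pure_succ (p q : ℕ) (hpq : p + (q + 1) = n + 1) (x : C p)
    (y : D (q + 1)) :
    rightHomotopy e hD n (pureTensor C D p (q + 1) hpq x y) =
      (-1 : k) ^ p • pureTensor C D p q (by omega) (e p x) (hD q y) := by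
  simp [rightHomotopy]

end homotopy

/-- The tensor product of two deformation retractions. -/
def Contraction.tensor {dC : ∀ p, C p →ₗ[k] C (p + 1)} {dD : ∀ p, D p →ₗ[k] D (p + 1)}
    {G H : ℕ → Type} [∀ p, AddCommGroup (G p)] [∀ p, Module k (G p)]
    [∀ p, AddCommGroup (H p)] [∀ p, Module k (H p)]
    (a : Contraction k dC G) (b : Contraction k dD H) :
    Contraction k (tensorD dC dD) (TC k G H) where
  i := tensorMap a.i b.i
  π := tensorMap a.π b.π
  h n := leftHomotopy a.h n + rightHomotopy (fun p => (a.i p).comp (a.π p)) b.h n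
  d_i n := LinearMap.congr_fun (f := (tensorD dC dD n).comp (tensorMap a.i b.i n)) (g := 0)
    (TC.hom_ext fun p q hpq x y => by simp [tensorD_pure, a.d_i, b.d_i])
  π_d n := LinearMap.congr_fun (f := (tensorMap a.π b.π (n + 1)).comp (tensorD dC dD n)) (g := 0)
    (TC.hom_ext fun p q hpq x y => by simp [tensorD_pure, a.π_d, b.π_d])
  π_i n := LinearMap.congr_fun (f := (tensorMap a.π b.π n).comp (tensorMap a.i b.i n))
    (g := LinearMap.id) (TC.hom_ext fun p q hpq x y => by simp [a.π_i, b.π_i])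
  h_d_zero := LinearMap.congr_fun
    (f := (leftHomotopy a.h 0 + rightHomotopy (fun p => (a.i p).comp (a.π p)) b.h 0).comp
      (tensorD dC dD 0))
    (g := LinearMap.id - (tensorMap a.i b.i 0).comp (tensorMap a.π b.π 0))
    (TC.hom_ext fun p q hpq x y => by
      obtain rfl : p = 0 := by omega
      obtain rfl : q = 0 := by omega
      simp [tensorD_pure, leftHomotopy_pure_zero, leftHomotopy_pure_succ, rightHomotopy_pure_zero,
        rightHomotopy_pure_succ, a.h_d_zero, b.h_d_zero])
  d_h n := LinearMap.congr_fun
    (f := (tensorD dC dD n).comp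
      (leftHomotopy a.h n + rightHomotopy (fun p => (a.i p).comp (a.π p)) b.h n))
    (g := LinearMap.id - (tensorMap a.i b.i (n + 1)).comp (tensorMap a.π b.π (n + 1)) -
      (leftHomotopy a.h (n + 1) + rightHomotopy (fun p => (a.i p).comp (a.π p)) b.h (n + 1)).comp
        (tensorD dC dD (n + 1)))
    (TC.hom_ext fun p q hpq x y => by
      have sign (p : ℕ) : (-1 : k) ^ p * (-1) ^ p = 1 := by simp [← mul_pow]
      rcases p with _ | p <;> rcases q with _ | q
      · omega
      all_goals
        simp [tensorD_pure, leftHomotopy_pure_zero, leftHomotopy_pure_succ,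
          rightHomotopy_pure_zero, rightHomotopy_pure_succ, a.h_d_zero, b.h_d_zero, a.d_h, b.d_h,
          a.d_i, a.π_d, smul_smul, sign, pow_succ]
      all_goals module)

end TensorProduct

theorem kunneth
    (C D : ℕ → Type)
    [∀ p, AddCommGroup (C p)] [∀ p, Module k (C p)]
    [∀ p, AddCommGroup (D p)] [∀ p, Module k (D p)]
    (dC : ∀ p, C p →ₗ[k] C (p + 1)) (dD : ∀ p, D p →ₗ[k] D (p + 1))
    (hC : ∀ p, (dC (p + 1)).comp (dC p) = 0)
    (hD : ∀ p, (dD (p + 1)).comp (dD p) = 0) :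
    ∃ d : ∀ n, TC k C D n →ₗ[k] TC k C D (n + 1),
      -- the differential of the tensor product complex, on pure tensors
      (∀ (n : ℕ) (s : Idx n) (x : C s.1.1) (y : D s.1.2),
        d n (DirectSum.lof k (Idx n) (fun s => C s.1.1 ⊗[k] D s.1.2) s (x ⊗ₜ[k] y)) =
          DirectSum.lof k (Idx (n + 1)) (fun s => C s.1.1 ⊗[k] D s.1.2)
              ⟨(s.1.1 + 1, s.1.2), by have h := s.2; omega⟩ ((dC s.1.1 x) ⊗ₜ[k] y)
            + ((-1 : k) ^ s.1.1) •
              DirectSum.lof k (Idx (n + 1)) (fun s => C s.1.1 ⊗[k] D s.1.2)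
                ⟨(s.1.1, s.1.2 + 1), by have h := s.2; omega⟩ (x ⊗ₜ[k] (dD s.1.2 y))) ∧
      -- it squares to zero
      (∀ n, (d (n + 1)).comp (d n) = 0) ∧
      -- Künneth isomorphism
      (∀ n, Nonempty
        (Coh k d n ≃ₗ[k] ⨁ (s : Idx n), (Coh k dC s.1.1 ⊗[k] Coh k dD s.1.2))) := by
  obtain ⟨a⟩ := nonempty_contraction_coh hC
  obtain ⟨b⟩ := nonempty_contraction_coh hD
  exact ⟨tensorD dC dD, fun n s => tensorD_pure dC dD s.1.1 s.1.2 s.2,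
    tensorD_comp_tensorD hC hD, fun n => ⟨(a.tensor b).cohEquiv n⟩⟩

end Kunneth
end
end

section
/- Trace decomposition of invariant Minkowski tensors: let t_{μ1...μn} be a real rank-n tensor on Minkowski space which is Lorentz covariant and parity invariant. Then t can be written as t_{μ1...μn} = Σ_P (η_{I1}···η_{Ik} t^P_{I0})_{μ1...μn}, where the sum runs over all partitions P = {I0, I1, ..., Ik} of the index positions {1,...,n} with |I1| = ··· = |Ik| = 2, and each t^P_{I0} is a traceless tensor of rank |I0| which is itself Lorentz covariant and parity invariant; moreover the tensors t^P_{I0} can be chosen to be linear combinations of iterated η-traces of t. -/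
noncomputable section

open scoped BigOperators

namespace MinkTensors

/-- A real rank-`n` tensor on Minkowski space. -/
abbrev MinkTensor (n : ℕ) : Type := (Fin n → Fin 4) → ℝ

/-- The Minkowski metric `η = diag(1,-1,-1,-1)` (which coincides with its inverse). -/
def η (μ ν : Fin 4) : ℝ := if μ = ν then (if μ = 0 then 1 else -1) else 0

/-- `Λ` is a Lorentz transformation: `Λᵀ η Λ = η`. -/
def IsLorentz (Λ : Matrix (Fin 4) (Fin 4) ℝ) : Prop :=
  ∀ μ ν, ∑ ρ : Fin 4, ∑ σ : Fin 4, Λ ρ μ * η ρ σ * Λ σ ν = η μ ν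

/-- `Λ` belongs to the proper orthochronous Lorentz group `SO⁺(1,3)`. -/
def IsProperOrtho (Λ : Matrix (Fin 4) (Fin 4) ℝ) : Prop :=
  IsLorentz Λ ∧ Λ.det = 1 ∧ 1 ≤ Λ 0 0

/-- The parity transformation `diag(1,-1,-1,-1)`. -/
def parityMat : Matrix (Fin 4) (Fin 4) ℝ := Matrix.of fun μ ν => η μ ν

/-- The action `t ↦ Λ^{ν₁}{}_{μ₁}···Λ^{ν_n}{}_{μ_n} t_{ν₁...ν_n}` of a matrix on rank-`n`
tensors. -/
def actT {n : ℕ} (Λ : Matrix (Fin 4) (Fin 4) ℝ) (t : MinkTensor n) : MinkTensor n :=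
  fun idx => ∑ νs : Fin n → Fin 4, (∏ i, Λ (νs i) (idx i)) * t νs

/-- The tensor is Lorentz covariant (invariant under `SO⁺(1,3)`) and parity invariant. -/
def IsInvariant {n : ℕ} (t : MinkTensor n) : Prop :=
  (∀ Λ, IsProperOrtho Λ → actT Λ t = t) ∧ actT parityMat t = t

/-- The tensor is traceless: every `η`-contraction of two of its indices vanishes. -/
def Traceless {n : ℕ} (t : MinkTensor n) : Prop :=
  ∀ i j : Fin n, i ≠ j → ∀ idx : Fin n → Fin 4,
    ∑ c : Fin 4, η c c * t (Function.update (Function.update idx i c) j c) = 0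

/-- A splitting of the `n` index positions into `k` (ordered) pairs and `n - 2k` remaining
positions; this encodes a partition `{I₀, I₁, ..., I_k}` with `|I₁| = ⋯ = |I_k| = 2`. -/
abbrev PairSplit (n k : ℕ) : Type := (Fin k ⊕ (Fin k ⊕ Fin (n - 2 * k))) ≃ Fin n

/-- `η_{I₁}···η_{I_k} s_{I₀}` : place `η`-factors at the pairs of the splitting and the
tensor `s` at the remaining positions. -/
def place {n : ℕ} (k : ℕ) (e : PairSplit n k) (s : MinkTensor (n - 2 * k)) :
    MinkTensor n :=
  fun idx =>
    (∏ i : Fin k, η (idx (e (Sum.inl i))) (idx (e (Sum.inr (Sum.inl i))))) *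
      s fun j => idx (e (Sum.inr (Sum.inr j)))

/-- The iterated `η`-trace of `t` over the pairs of positions of the splitting. -/
def ctr {n : ℕ} (k : ℕ) (e : PairSplit n k) (t : MinkTensor n) :
    MinkTensor (n - 2 * k) :=
  fun idx => ∑ c : Fin k → Fin 4,
    (∏ i, η (c i) (c i)) *
      t fun pos =>
        match e.symm pos with
        | Sum.inl i => c i
        | Sum.inr (Sum.inl i) => c i
        | Sum.inr (Sum.inr j) => idx j

/-- The `η`-pairing `⟨t, s⟩ = η^{μ₁ν₁}···η^{μ_nν_n} t_{μ₁...μ_n} s_{ν₁...ν_n}`. -/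
def pairing {n : ℕ} (t s : MinkTensor n) : ℝ :=
  ∑ μs : Fin n → Fin 4, ∑ νs : Fin n → Fin 4,
    (∏ i, η (μs i) (νs i)) * t μs * s νs

/-- The trace stratum `T^n_k`: the span of the tensors `η_{I₁}···η_{I_k} s_{I₀}` with `s`
traceless. -/
def stratum (n k : ℕ) : Submodule ℝ (MinkTensor n) :=
  Submodule.span ℝ
    {t | ∃ (e : PairSplit n k) (s : MinkTensor (n - 2 * k)), Traceless s ∧ t = place k e s}

end MinkTensors

namespace MinkTensors

open Function Equiv

variable {ι : Type} [Fintype ι] [DecidableEq ι]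

/-- Invariance under the infinitesimal Lorentz transformation in every plane `(a, b)`. -/
def InfInv (t : (ι → Fin 4) → ℝ) : Prop :=
  ∀ (a b : Fin 4) (idx : ι → Fin 4),
    ∑ i, ((if idx i = b then η a a * t (update idx i a) else 0) -
      (if idx i = a then η b b * t (update idx i b) else 0)) = 0

/-- Parity invariance in components. -/
def ParInv (t : (ι → Fin 4) → ℝ) : Prop :=
  ∀ idx : ι → Fin 4, (∏ i, η (idx i) (idx i)) * t idx = t idx

lemma η_sq (a : Fin 4) : η a a * η a a = 1 := by
  by_cases h : a = 0 <;> simp [η, h]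

lemma η_ne {a b : Fin 4} (h : a ≠ b) : η a b = 0 := by simp [η, h]

/-- The Casimir identity for one tensor position, on traceless tensors. -/
lemma InfInv.casimir {t : (ι → Fin 4) → ℝ} (ht : InfInv t)
    (htr : ∀ i j : ι, i ≠ j → ∀ idx : ι → Fin 4,
      ∑ c : Fin 4, η c c * t (update (update idx i c) j c) = 0)
    (i : ι) (idx : ι → Fin 4) :
    3 * t idx + ∑ j ∈ Finset.univ.erase i, t (idx ∘ swap i j) = 0 := by
  have h : ∑ a, ∑ j, ((if update idx i a j = idx i then
        η a a * t (update (update idx i a) j a) else 0) -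
      (if update idx i a j = a then η (idx i) (idx i) * t (update (update idx i a) j (idx i))
        else 0)) = 0 :=
    Finset.sum_eq_zero fun a _ => ht a (idx i) (update idx i a)
  rw [Finset.sum_comm, ← Finset.add_sum_erase _ _ (Finset.mem_univ i)] at h
  have hi : ∑ a, ((if update idx i a i = idx i then
        η a a * t (update (update idx i a) i a) else 0) -
      (if update idx i a i = a then η (idx i) (idx i) * t (update (update idx i a) i (idx i))
        else 0)) = -3 * (η (idx i) (idx i) * t idx) := by
    simp only [update_self, update_idem, update_eq_self, if_true, Finset.sum_sub_distrib]
    rw [Finset.sum_ite_eq' Finset.univ (idx i) (fun a => η a a * t (update idx i a))]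
    simp only [Finset.mem_univ, if_true, update_eq_self, Finset.sum_const, Finset.card_univ,
      Fintype.card_fin, nsmul_eq_mul]
    push_cast
    ring
  have hj : ∀ j ∈ Finset.univ.erase i, ∑ a, ((if update idx i a j = idx i then
        η a a * t (update (update idx i a) j a) else 0) -
      (if update idx i a j = a then η (idx i) (idx i) * t (update (update idx i a) j (idx i))
        else 0)) = - (η (idx i) (idx i) * t (idx ∘ swap i j)) := by
    intro j hj
    have hji : j ≠ i := Finset.ne_of_mem_erase hj
    have hsw : update (update idx i (idx j)) j (idx i) = idx ∘ swap i j := by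
      funext x
      by_cases hx : x = j
      · subst hx; simp
      · by_cases hx' : x = i
        · subst hx'; simp [hx]
        · simp [hx, hx', swap_apply_of_ne_of_ne hx' hx]
    simp only [update_of_ne hji, Finset.sum_sub_distrib]
    rw [Finset.sum_ite_eq Finset.univ (idx j)
      (fun a => η (idx i) (idx i) * t (update (update idx i a) j (idx i)))]
    by_cases hc : idx j = idx i
    · simp only [hc, if_true, htr i j hji.symm idx, Finset.mem_univ, ← hsw]
      simp
    · simp [hc, hsw]
  rw [hi, Finset.sum_congr rfl hj, Finset.sum_neg_distrib, ← Finset.mul_sum] at h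
  have h2 : η (idx i) (idx i) * (η (idx i) (idx i) *
      (3 * t idx + ∑ j ∈ Finset.univ.erase i, t (idx ∘ swap i j))) = 0 := by
    rw [show η (idx i) (idx i) * (3 * t idx + ∑ j ∈ Finset.univ.erase i, t (idx ∘ swap i j)) = 0
      by linarith, mul_zero]
  rwa [← mul_assoc, η_sq, one_mul] at h2

variable (ι) in
/-- Parity-invariant tensors satisfying the Casimir identity of traceless tensors. -/
def casimirSpace : Submodule ℝ ((ι → Fin 4) → ℝ) where
  carrier := {u | (∀ i idx, 3 * u idx + ∑ j ∈ Finset.univ.erase i, u (idx ∘ swap i j) = 0) ∧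
    ParInv u}
  zero_mem' := by simp [ParInv]
  add_mem' := by
    rintro u v ⟨hu, hu'⟩ ⟨hv, hv'⟩
    refine ⟨fun i idx => ?_, fun idx => ?_⟩
    · simp only [Pi.add_apply, Finset.sum_add_distrib]
      linarith [hu i idx, hv i idx]
    · simp only [Pi.add_apply, mul_add, hu' idx, hv' idx]
  smul_mem' := by
    rintro c u ⟨hu, hu'⟩
    refine ⟨fun i idx => ?_, fun idx => ?_⟩
    · simp only [Pi.smul_apply, smul_eq_mul, ← Finset.mul_sum]
      linear_combination c * hu i idx
    · simp only [Pi.smul_apply, smul_eq_mul]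
      linear_combination c * hu' idx

lemma casimirSpace_perm {u : (ι → Fin 4) → ℝ} (hu : u ∈ casimirSpace ι) (σ : Perm ι) :
    (fun idx => u (idx ∘ σ)) ∈ casimirSpace ι := by
  refine ⟨fun i idx => ?_, fun idx => ?_⟩
  · rw [← hu.1 (σ.symm i) (idx ∘ σ)]
    congr 1
    refine Finset.sum_equiv σ.symm (by simp) fun j _ => congrArg u ?_
    funext x
    have := σ.injective.swap_apply (σ.symm i) (σ.symm j) x
    simp only [apply_symm_apply] at this
    simp only [comp_apply, this]
  · have := hu.2 (idx ∘ σ)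
    simp only [comp_apply] at this
    rwa [Equiv.prod_comp σ (fun i => η (idx i) (idx i))] at this

/-- Antisymmetry under exchange of positions in `A`. -/
def AntiOn (A : Finset ι) (u : (ι → Fin 4) → ℝ) : Prop :=
  ∀ i ∈ A, ∀ j ∈ A, i ≠ j → ∀ idx, u (idx ∘ swap i j) = - u idx

omit [Fintype ι] in
lemma AntiOn.eq_zero_of_eq {A : Finset ι} {u : (ι → Fin 4) → ℝ} (h : AntiOn A u) {i j : ι}
    (hi : i ∈ A) (hj : j ∈ A) (hij : i ≠ j) {idx : ι → Fin 4} (he : idx i = idx j) :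
    u idx = 0 := by
  have h1 := h i hi j hj hij idx
  have h2 : idx ∘ swap i j = idx := by
    funext x
    by_cases hx : x = i
    · subst hx; simp [he]
    · by_cases hx' : x = j
      · subst hx'; simp [he]
      · simp [swap_apply_of_ne_of_ne hx hx']
  rw [h2] at h1
  linarith

omit [Fintype ι] in
lemma AntiOn.insert_sub {A : Finset ι} {u : (ι → Fin 4) → ℝ} (h : AntiOn A u) {x : ι}
    (hx : x ∉ A) :
    AntiOn (insert x A) (u - ∑ j ∈ A, fun idx => u (idx ∘ swap j x)) := by
  have key : ∀ i ∈ A, ∀ idx, (u - ∑ j ∈ A, fun idx => u (idx ∘ swap j x)) (idx ∘ swap i x) =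
      - (u - ∑ j ∈ A, fun idx => u (idx ∘ swap j x)) idx := by
    intro i hi idx
    simp only [Pi.sub_apply, Finset.sum_apply]
    rw [← Finset.add_sum_erase _ _ hi, ← Finset.add_sum_erase _ _ hi]
    have h1 : (idx ∘ swap i x) ∘ swap i x = idx := by
      funext y; simp
    have h2 : ∀ j ∈ A.erase i, u ((idx ∘ swap i x) ∘ swap j x) = - u (idx ∘ swap j x) := by
      intro j hj
      have hj' := Finset.mem_of_mem_erase hj
      have hji := Finset.ne_of_mem_erase hj
      rw [← h i hi j hj' hji.symm]
      congr 1
      funext y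
      simp only [comp_apply]
      congr 1
      have hxi : x ≠ i := fun e => hx (e ▸ hi)
      have hxj : x ≠ j := fun e => hx (e ▸ hj')
      simp only [swap_apply_def]
      split_ifs <;> simp_all
    rw [h1, Finset.sum_congr rfl h2, Finset.sum_neg_distrib]
    ring
  intro i hi j hj hij idx
  rcases Finset.mem_insert.1 hi with rfl | hi
  · rcases Finset.mem_insert.1 hj with rfl | hj
    · exact absurd rfl hij
    · rw [swap_comm]; exact key j hj idx
  · rcases Finset.mem_insert.1 hj with hj | hj
    · rw [hj]; exact key i hi idx
    · simp only [Pi.sub_apply, Finset.sum_apply, h i hi j hj hij idx]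
      have : ∑ c ∈ A, u ((idx ∘ swap i j) ∘ swap c x) = - ∑ c ∈ A, u (idx ∘ swap c x) := by
        rw [← Finset.sum_neg_distrib]
        refine Finset.sum_equiv (swap i j) (fun c => ?_) fun c hc => ?_
        · simp only [swap_apply_def]
          split_ifs with h1 h2
          · subst h1; simp [hi, hj]
          · subst h2; simp [hi, hj]
          · rfl
        · rw [← h i hi j hj hij]
          congr 1
          funext y
          have hxi : x ≠ i := fun e => hx (e ▸ hi)
          have hxj : x ≠ j := fun e => hx (e ▸ hj)
          simp only [comp_apply]
          congr 1
          have hs : swap i j (swap c x y) = swap (swap i j c) (swap i j x) (swap i j y) :=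
            ((swap i j).injective.swap_apply c x y).symm
          rw [hs, swap_apply_of_ne_of_ne hxi hxj]
      rw [this]; ring

lemma prod_η_eq : ∏ c : Fin 4, η c c = -1 := by
  simp [Fin.prod_univ_four, η]

/-- An element of the Casimir space antisymmetric on a nonempty set of positions is zero. -/
lemma AntiOn.eq_zero (A : Finset ι) (hA : A.Nonempty) (u : (ι → Fin 4) → ℝ)
    (hu : u ∈ casimirSpace ι) (h : AntiOn A u) : u = 0 := by
  induction hd : Fintype.card ι - A.card using Nat.strong_induction_on generalizing A u with
  | _ d ih =>
    have hAle : A.card ≤ Fintype.card ι := Finset.card_le_univ A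
    have hv : ∀ x ∉ A, ∀ idx, ∑ j ∈ A, u (idx ∘ swap j x) = u idx := by
      intro x hx idx
      have hc : (insert x A).card = A.card + 1 := Finset.card_insert_of_notMem hx
      have hc' : (insert x A).card ≤ Fintype.card ι := Finset.card_le_univ _
      have h0 := ih _ (by omega) (insert x A) (Finset.insert_nonempty x A)
        (u - ∑ j ∈ A, fun idx => u (idx ∘ swap j x))
        (Submodule.sub_mem _ hu (Submodule.sum_mem _ fun j _ => casimirSpace_perm hu _))
        (h.insert_sub hx) rfl
      have h1 := congrFun h0 idx
      simp only [Pi.sub_apply, Finset.sum_apply, Pi.zero_apply] at h1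
      linarith
    funext idx
    by_contra hne
    rw [Pi.zero_apply] at hne
    have hinj : Set.InjOn idx A := by
      intro i hi j hj he
      by_contra hij
      exact hne (h.eq_zero_of_eq hi hj hij he)
    have hA4 : A.card ≤ 4 := by
      have := Finset.card_le_univ (A.image idx)
      rwa [Finset.card_image_of_injOn hinj, Fintype.card_fin] at this
    have hsum : ∑ i ∈ A, (3 * u idx + ∑ j ∈ Finset.univ.erase i, u (idx ∘ swap i j)) = 0 :=
      Finset.sum_eq_zero fun i _ => hu.1 i idx
    have hsplit : ∀ i ∈ A, ∑ j ∈ Finset.univ.erase i, u (idx ∘ swap i j) =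
        -((A.card : ℝ) - 1) * u idx + ∑ x ∈ Aᶜ, u (idx ∘ swap i x) := by
      intro i hi
      have hun : Finset.univ.erase i = A.erase i ∪ Aᶜ := by
        ext x
        simp only [Finset.mem_erase, Finset.mem_univ, Finset.mem_union, Finset.mem_compl]
        by_cases hx : x = i
        · simp [hx, hi]
        · simp [hx, em]
      have hdis : Disjoint (A.erase i) Aᶜ :=
        disjoint_compl_right.mono_left (Finset.erase_subset i A)
      rw [hun, Finset.sum_union hdis]
      congr 1
      rw [Finset.sum_congr rfl fun j hj => h i hi j (Finset.mem_of_mem_erase hj)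
        (Finset.ne_of_mem_erase hj).symm idx, Finset.sum_const, Finset.card_erase_of_mem hi,
        nsmul_eq_mul, Nat.cast_sub (Finset.card_pos.2 hA)]
      push_cast
      ring
    rw [Finset.sum_add_distrib, Finset.sum_congr rfl hsplit, Finset.sum_add_distrib,
      Finset.sum_comm (s := A) (t := Aᶜ),
      Finset.sum_congr rfl fun x hx => hv x (Finset.mem_compl.1 hx) idx] at hsum
    simp only [Finset.sum_const, Finset.card_compl, nsmul_eq_mul, Nat.cast_sub hAle] at hsum
    have hcoef : ((Fintype.card ι : ℝ) + 3 * A.card - (A.card : ℝ) ^ 2) * u idx = 0 := by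
      linear_combination hsum
    have hcoef' := (mul_eq_zero.1 hcoef).resolve_right hne
    have hnat : Fintype.card ι + 3 * A.card = A.card ^ 2 := by
      have : (Fintype.card ι : ℝ) + 3 * A.card = (A.card : ℝ) ^ 2 := by linarith
      exact_mod_cast this
    have hpos := Finset.card_pos.2 hA
    have hcard : A.card = 4 ∧ Fintype.card ι = 4 := by
      generalize A.card = m at *
      interval_cases m <;> omega
    have hAu : A = Finset.univ := (Finset.card_eq_iff_eq_univ A).1 (by omega)
    have hbij : Bijective idx := by
      refine (Fintype.bijective_iff_injective_and_card idx).2 ⟨?_, by simp [hcard.2]⟩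
      rw [hAu, Finset.coe_univ] at hinj
      exact Set.injOn_univ.1 hinj
    have hp := hu.2 idx
    rw [hbij.prod_comp (fun c => η c c), prod_η_eq] at hp
    exact hne (by linarith)

/-- A traceless invariant tensor of positive rank vanishes. -/
lemma InfInv.eq_zero_of_traceless [Nonempty ι] {t : (ι → Fin 4) → ℝ} (ht : InfInv t)
    (hp : ParInv t)
    (htr : ∀ i j : ι, i ≠ j → ∀ idx : ι → Fin 4,
      ∑ c : Fin 4, η c c * t (update (update idx i c) j c) = 0) : t = 0 := by
  obtain ⟨i⟩ := ‹Nonempty ι›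
  refine AntiOn.eq_zero {i} ⟨i, Finset.mem_singleton_self i⟩ t ⟨ht.casimir htr, hp⟩ ?_
  intro a ha b hb hab
  rw [Finset.mem_singleton] at ha hb
  exact absurd (ha.trans hb.symm) hab

/-- The infinitesimal form of invariance along a curve of Lorentz transformations. -/
lemma IsInvariant.deriv_eq_zero {n : ℕ} {t : MinkTensor n} (ht : IsInvariant t)
    (L : ℝ → Matrix (Fin 4) (Fin 4) ℝ) (M : Matrix (Fin 4) (Fin 4) ℝ)
    (hL : ∀ s, IsProperOrtho (L s)) (h0 : L 0 = 1)
    (hd : ∀ c d, HasDerivAt (fun s => L s c d) (M c d) 0) (idx : Fin n → Fin 4) :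
    ∑ i, ∑ c, M c (idx i) * t (update idx i c) = 0 := by
  have h1 : HasDerivAt (fun s => actT (L s) t idx)
      (∑ νs : Fin n → Fin 4, (∑ i, (∏ j ∈ Finset.univ.erase i, L 0 (νs j) (idx j)) •
        M (νs i) (idx i)) * t νs) 0 :=
    HasDerivAt.fun_sum fun νs _ =>
      (HasDerivAt.fun_finsetProd fun i _ => hd (νs i) (idx i)).mul_const (t νs)
  have h2 : HasDerivAt (fun s => actT (L s) t idx) 0 0 := by
    simp only [fun s => ht.1 (L s) (hL s)]
    exact hasDerivAt_const _ _
  refine Eq.trans ?_ (h1.unique h2)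
  simp only [Finset.sum_mul]
  rw [Finset.sum_comm (s := (Finset.univ : Finset (Fin n → Fin 4)))]
  refine Finset.sum_congr rfl fun i _ => ?_
  refine Finset.sum_of_injOn (s := Finset.univ) (fun c => update idx i c)
    (update_injective idx i).injOn (by simp [Set.MapsTo]) (fun νs _ hνs => ?_) (fun c _ => ?_)
  · obtain ⟨j, hj, hne⟩ : ∃ j ∈ Finset.univ.erase i, νs j ≠ idx j := by
      by_contra! hall
      refine hνs ⟨νs i, by simp, ?_⟩
      funext j
      by_cases hj : j = i
      · subst hj; simp
      · simp [hj, hall j (by simp [hj])]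
    have hz : L 0 (νs j) (idx j) = 0 := by rw [h0]; exact Matrix.one_apply_ne hne
    rw [Finset.prod_eq_zero hj hz, zero_smul, zero_mul]
  · rw [Finset.prod_eq_one fun j hj => ?_]
    · simp
    · simp [h0, Finset.ne_of_mem_erase hj]

lemma IsInvariant.parInv {n : ℕ} {t : MinkTensor n} (ht : IsInvariant t) : ParInv t := by
  intro idx
  conv_rhs => rw [← ht.2]
  simp only [actT, parityMat, Matrix.of_apply]
  rw [Finset.sum_eq_single idx]
  · intro νs _ hne
    obtain ⟨i, hi⟩ := Function.ne_iff.1 hne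
    rw [Finset.prod_eq_zero (Finset.mem_univ i) (η_ne hi), zero_mul]
  · simp

/-- The Lorentz transformation in the plane `(a, b)` with diagonal entry `C` and
off-diagonal entry `S`. -/
def planeMat (a b : Fin 4) (C S : ℝ) : Matrix (Fin 4) (Fin 4) ℝ :=
  Matrix.of fun c d => (if c = d then (if c = a ∨ c = b then C else 1) else 0) +
    S * (η c c * ((if c = a ∧ d = b then 1 else 0) - (if c = b ∧ d = a then 1 else 0)))

set_option maxHeartbeats 2000000 in
lemma planeMat_isLorentz {a b : Fin 4} (hab : a ≠ b) {C S : ℝ}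
    (h : C ^ 2 + η a a * η b b * S ^ 2 = 1) : IsLorentz (planeMat a b C S) := by
  intro μ ν
  simp only [planeMat, Matrix.of_apply, Fin.sum_univ_four]
  fin_cases a <;> fin_cases b <;> first | exact absurd rfl hab | skip
  all_goals fin_cases μ <;> fin_cases ν <;> simp [η] at h ⊢ <;> linarith

set_option maxHeartbeats 2000000 in
lemma planeMat_det {a b : Fin 4} (hab : a ≠ b) {C S : ℝ}
    (h : C ^ 2 + η a a * η b b * S ^ 2 = 1) : (planeMat a b C S).det = 1 := by
  rw [Matrix.det_succ_row_zero]
  simp only [Matrix.det_fin_three, planeMat, Matrix.of_apply, Fin.sum_univ_four,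
    Matrix.submatrix_apply]
  fin_cases a <;> fin_cases b <;> first | exact absurd rfl hab | skip
  all_goals
    simp [η, Fin.succAbove] at h ⊢
    linarith

lemma planeMat_isProperOrtho {a b : Fin 4} (hab : a ≠ b) {C S : ℝ}
    (h : C ^ 2 + η a a * η b b * S ^ 2 = 1) (hC : a = 0 ∨ b = 0 → 1 ≤ C) :
    IsProperOrtho (planeMat a b C S) := by
  refine ⟨planeMat_isLorentz hab h, planeMat_det hab h, ?_⟩
  by_cases h0 : a = 0 ∨ b = 0
  · have := hC h0
    rcases h0 with rfl | rfl <;> simp [planeMat, hab, hab.symm, this]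
  · push Not at h0
    simp [planeMat, h0.1.symm, h0.2.symm]

lemma IsInvariant.infInv {n : ℕ} {t : MinkTensor n} (ht : IsInvariant t) : InfInv t := by
  have key : ∀ (a b : Fin 4), a ≠ b → ∀ (C S : ℝ → ℝ),
      (∀ s, C s ^ 2 + η a a * η b b * S s ^ 2 = 1) → (a = 0 ∨ b = 0 → ∀ s, 1 ≤ C s) →
      C 0 = 1 → S 0 = 0 → HasDerivAt C 0 0 → HasDerivAt S 1 0 → ∀ idx : Fin n → Fin 4,
      ∑ i, ((if idx i = b then η a a * t (update idx i a) else 0) -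
        (if idx i = a then η b b * t (update idx i b) else 0)) = 0 := by
    intro a b hab C S hCS hC hC0 hS0 hCd hSd idx
    have h := ht.deriv_eq_zero (fun s => planeMat a b (C s) (S s))
      (fun c d => η c c * ((if c = a ∧ d = b then 1 else 0) - (if c = b ∧ d = a then 1 else 0)))
      (fun s => planeMat_isProperOrtho hab (hCS s) fun h => hC h s)
      (by ext c d; simp [planeMat, hC0, hS0, Matrix.one_apply])
      (fun c d => by
        simp only [planeMat, Matrix.of_apply]
        refine HasDerivAt.congr_deriv (HasDerivAt.add (f' := 0) ?_ (hSd.mul_const _)) (by simp)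
        split_ifs
        · exact hCd
        · exact hasDerivAt_const _ _
        · exact hasDerivAt_const _ _) idx
    refine (Finset.sum_congr rfl fun i _ => ?_).trans h
    simp only [mul_sub, sub_mul, Finset.sum_sub_distrib]
    congr 1
    · rw [Finset.sum_eq_single a (fun c _ hc => by simp [hc]) (by simp)]
      by_cases hi : idx i = b <;> simp [hi]
    · rw [Finset.sum_eq_single b (fun c _ hc => by simp [hc]) (by simp)]
      by_cases hi : idx i = a <;> simp [hi]
  intro a b idx
  by_cases hab : a = b
  · subst hab; simp
  by_cases h0 : a = 0 ∨ b = 0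
  · refine key a b hab Real.cosh Real.sinh (fun s => ?_) (fun _ => Real.one_le_cosh)
      Real.cosh_zero Real.sinh_zero ?_ ?_ idx
    · have hg : η a a * η b b = -1 := by
        rcases h0 with rfl | rfl
        · simp [η, Ne.symm hab]
        · simp [η, hab]
      rw [hg]
      linarith [Real.cosh_sq s]
    · simpa using Real.hasDerivAt_cosh 0
    · simpa using Real.hasDerivAt_sinh 0
  · refine key a b hab Real.cos Real.sin (fun s => ?_) (fun h => absurd h h0)
      Real.cos_zero Real.sin_zero ?_ ?_ idx
    · push Not at h0
      have hg : η a a * η b b = 1 := by simp [η, h0.1, h0.2]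
      rw [hg, one_mul, Real.cos_sq_add_sin_sq]
    · simpa using Real.hasDerivAt_cos 0
    · simpa using Real.hasDerivAt_sin 0

section Reindex

variable {ι' : Type} [Fintype ι'] [DecidableEq ι']

lemma InfInv.reindex {t : (ι → Fin 4) → ℝ} (ht : InfInv t) (E : ι' ≃ ι) :
    InfInv fun f : ι' → Fin 4 => t (f ∘ E.symm) := by
  intro a b f
  refine (Fintype.sum_equiv E _ _ fun x => ?_).trans (ht a b (f ∘ E.symm))
  have hup : ∀ c, update f x c ∘ E.symm = update (f ∘ E.symm) (E x) c := by
    intro c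
    rw [update_comp_equiv]
    simp
  simp [hup]

omit [DecidableEq ι] [DecidableEq ι'] in
lemma ParInv.reindex {t : (ι → Fin 4) → ℝ} (ht : ParInv t) (E : ι' ≃ ι) :
    ParInv fun f : ι' → Fin 4 => t (f ∘ E.symm) := by
  intro f
  have h := ht (f ∘ E.symm)
  simp only [comp_apply] at h
  rwa [Equiv.prod_comp E.symm (fun i => η (f i) (f i))] at h

end Reindex

section Trace

/-- Extend an index by two further values. -/
def consTwo {α : Type} (c d : Fin 4) (f : α → Fin 4) : Option (Option α) → Fin 4
  | none => c
  | some none => d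
  | some (some x) => f x

/-- The `η`-trace over the two added positions. -/
def traceTwo {α : Type} (t : (Option (Option α) → Fin 4) → ℝ) : (α → Fin 4) → ℝ :=
  fun f => ∑ c, η c c * t (consTwo c c f)

lemma InfInv.traceTwo {t : (Option (Option ι) → Fin 4) → ℝ} (ht : InfInv t) :
    InfInv (traceTwo t) := by
  intro a b f
  have h : ∑ c, η c c * ∑ i, ((if consTwo c c f i = b then
      η a a * t (update (consTwo c c f) i a) else 0) -
      (if consTwo c c f i = a then η b b * t (update (consTwo c c f) i b) else 0)) = 0 :=
    Finset.sum_eq_zero fun c _ => by rw [ht a b (consTwo c c f), mul_zero]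
  have u1 : ∀ c d e, update (consTwo c d f) none e = consTwo e d f := by
    intro c d e; funext x; rcases x with _ | _ | x <;> simp [consTwo]
  have u2 : ∀ c d e, update (consTwo c d f) (some none) e = consTwo c e f := by
    intro c d e; funext x; rcases x with _ | _ | x <;> simp [consTwo]
  have u3 : ∀ c d e x, update (consTwo c d f) (some (some x)) e =
      consTwo c d (update f x e) := by
    intro c d e x; funext y
    rcases y with _ | _ | y
    · simp [consTwo]
    · simp [consTwo]
    · by_cases hy : y = x
      · subst hy; simp [consTwo]
      · simp [consTwo, hy]
  have v1 : ∀ c d, consTwo c d f none = c := fun _ _ => by simp [consTwo]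
  have v2 : ∀ c d, consTwo c d f (some none) = d := fun _ _ => by simp [consTwo]
  have v3 : ∀ c d x, consTwo c d f (some (some x)) = f x := fun _ _ _ => by simp [consTwo]
  simp only [Fintype.sum_option, u1, u2, u3, v1, v2, v3, mul_add, Finset.sum_add_distrib] at h
  have h1 : ∀ F : Fin 4 → ℝ, ∀ d, ∑ c, η c c * (if c = d then F c else 0) = η d d * F d := by
    intro F d
    rw [Finset.sum_eq_single d (fun c _ hc => by simp [hc]) (by simp), if_pos rfl]
  simp only [mul_sub, Finset.sum_sub_distrib,
    h1 (fun c => η a a * t (consTwo a c f)), h1 (fun c => η b b * t (consTwo b c f)),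
    h1 (fun c => η a a * t (consTwo c a f)), h1 (fun c => η b b * t (consTwo c b f))] at h
  simp only [MinkTensors.traceTwo, Finset.sum_sub_distrib]
  have h2 : ∀ (d e : Fin 4), ∑ c, η c c * ∑ i, (if f i = d then
      η e e * t (consTwo c c (update f i e)) else 0) =
      ∑ i, if f i = d then η e e * ∑ c, η c c * t (consTwo c c (update f i e)) else 0 := by
    intro d e
    simp only [Finset.mul_sum]
    rw [Finset.sum_comm]
    refine Finset.sum_congr rfl fun i _ => ?_
    split_ifs
    · exact Finset.sum_congr rfl fun c _ => by ring
    · simp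
  rw [h2, h2] at h
  linarith

omit [DecidableEq ι] in
lemma ParInv.traceTwo {t : (Option (Option ι) → Fin 4) → ℝ} (ht : ParInv t) :
    ParInv (traceTwo t) := by
  intro f
  simp only [MinkTensors.traceTwo, Finset.mul_sum]
  refine Finset.sum_congr rfl fun c _ => ?_
  have h := ht (consTwo c c f)
  simp only [Fintype.prod_option, consTwo] at h
  rw [← mul_assoc, η_sq, one_mul] at h
  linear_combination η c c * h

/-- The full `η`-trace of a tensor over a perfect matching of its positions. -/
def fullTrace {κ α : Type} [Fintype κ] [DecidableEq κ] (e : κ ⊕ κ ≃ α)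
    (t : (α → Fin 4) → ℝ) : ℝ :=
  ∑ c : κ → Fin 4, (∏ x, η (c x) (c x)) * t (Sum.elim c c ∘ e.symm)

/-- Extend a perfect matching by one pair. -/
def consPair {κ α : Type} (e : κ ⊕ κ ≃ α) : Option κ ⊕ Option κ ≃ Option (Option α) where
  toFun
    | .inl none => none
    | .inr none => some none
    | .inl (some x) => some (some (e (.inl x)))
    | .inr (some x) => some (some (e (.inr x)))
  invFun
    | none => .inl none
    | some none => .inr none
    | some (some y) => Sum.map some some (e.symm y)
  left_inv := by rintro ((_ | x) | (_ | x)) <;> simp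
  right_inv := by
    rintro (_ | _ | y)
    · rfl
    · rfl
    · obtain ⟨x, rfl⟩ := e.surjective y
      rcases x with x | x <;> simp

lemma fullTrace_traceTwo {κ α : Type} [Fintype κ] [DecidableEq κ] (e : κ ⊕ κ ≃ α)
    (t : (Option (Option α) → Fin 4) → ℝ) :
    fullTrace e (traceTwo t) = fullTrace (consPair e) t := by
  unfold fullTrace
  rw [Fintype.sum_equiv (Equiv.piOptionEquivProd (β := fun _ : Option κ => Fin 4)) _
    (fun p => η p.1 p.1 * (∏ x, η (p.2 x) (p.2 x)) *
      t (consTwo p.1 p.1 (Sum.elim p.2 p.2 ∘ e.symm))) fun c => ?_]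
  · rw [Fintype.sum_prod_type, Finset.sum_comm]
    refine Finset.sum_congr rfl fun c _ => ?_
    rw [traceTwo, Finset.mul_sum]
    exact Finset.sum_congr rfl fun d _ => by ring
  · rw [Fintype.prod_option]
    congr 2
    funext y
    rcases y with _ | _ | y
    · rfl
    · rfl
    · obtain ⟨x, rfl⟩ := e.surjective y
      rcases x with x | x <;> simp [consPair, consTwo, Equiv.piOptionEquivProd]

/-- Some full `η`-trace of a nonzero invariant tensor is nonzero. -/
lemma exists_fullTrace_ne_zero (m : ℕ) : ∀ (ι : Type) [Fintype ι] [DecidableEq ι]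
    (t : (ι → Fin 4) → ℝ), Fintype.card ι = m → InfInv t → ParInv t → t ≠ 0 →
    ∃ (k : ℕ) (e : Fin k ⊕ Fin k ≃ ι), fullTrace e t ≠ 0 := by
  suffices h : ∀ (ι : Type) [Fintype ι] [DecidableEq ι]
      (t : (ι → Fin 4) → ℝ), Fintype.card ι = m → InfInv t → ParInv t → t ≠ 0 →
      ∃ (κ : Type) (_ : Fintype κ) (_ : DecidableEq κ) (e : κ ⊕ κ ≃ ι), fullTrace e t ≠ 0 by
    intro ι _ _ t hc ht hp h0
    obtain ⟨κ, _, _, e, he⟩ := h ι t hc ht hp h0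
    let φ := (Fintype.equivFin κ).symm
    refine ⟨_, (Equiv.sumCongr φ φ).trans e, ?_⟩
    convert he using 1
    unfold fullTrace
    refine Fintype.sum_equiv (Equiv.arrowCongr φ (Equiv.refl _)) _ _ fun c => ?_
    congr 1
    · exact Fintype.prod_equiv φ _ _ fun x => by simp [Equiv.arrowCongr]
    · congr 1
      funext y
      obtain ⟨x, rfl⟩ := e.surjective y
      rcases x with x | x <;> simp [Equiv.arrowCongr]
  induction m using Nat.strong_induction_on with
  | _ m ih =>
  intro ι _ _ t hc ht hp h0
  rcases isEmpty_or_nonempty ι with hι | hι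
  · refine ⟨Empty, inferInstance, inferInstance, Equiv.equivOfIsEmpty _ _, fun h => h0 ?_⟩
    funext idx
    simp only [fullTrace, Finset.univ_eq_empty, Finset.prod_empty, one_mul,
      Fintype.sum_unique] at h
    rw [Pi.zero_apply, ← h]
    exact congrArg t (Subsingleton.elim _ _)
  · have hnt : ∃ i j : ι, i ≠ j ∧ ∃ idx : ι → Fin 4,
        ∑ c : Fin 4, η c c * t (update (update idx i c) j c) ≠ 0 := by
      by_contra! hall
      exact h0 (ht.eq_zero_of_traceless hp hall)
    obtain ⟨i, j, hij, idx, hne⟩ := hnt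
    let j' : {x // x ≠ i} := ⟨j, hij.symm⟩
    let E : Option (Option {x : {x // x ≠ i} // x ≠ j'}) ≃ ι :=
      (Equiv.optionCongr (Equiv.optionSubtypeNe j')).trans (Equiv.optionSubtypeNe i)
    have hEi : E none = i := by simp [E]
    have hEj : E (some none) = j := by simp [E, j']
    have hcard : Fintype.card {x : {x // x ≠ i} // x ≠ j'} < m := by
      have := Fintype.card_congr E
      simp only [Fintype.card_option] at this
      omega
    have hs : traceTwo (fun f => t (f ∘ E.symm)) ≠ 0 := by
      intro hz
      apply hne
      have := congrFun hz (fun x => idx (E (some (some x))))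
      rw [Pi.zero_apply] at this
      rw [← this]
      refine Finset.sum_congr rfl fun c _ => ?_
      congr 2
      funext y
      obtain ⟨x, rfl⟩ := E.surjective y
      rcases x with _ | _ | x
      · simp [hEi, E.symm_apply_eq.2 hEi.symm, consTwo, update_of_ne hij]
      · simp [hEj, E.symm_apply_eq.2 hEj.symm, consTwo]
      · have h1 : E (some (some x)) ≠ i := fun h => by simpa using E.injective (h.trans hEi.symm)
        have h2 : E (some (some x)) ≠ j := fun h => by simpa using E.injective (h.trans hEj.symm)
        simp [h1, h2, consTwo]
    obtain ⟨κ, _, _, e, he⟩ := ih _ hcard _ _ rfl (ht.reindex E).traceTwo (hp.reindex E).traceTwo hs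
    refine ⟨Option κ, inferInstance, inferInstance, (consPair e).trans E, ?_⟩
    rw [fullTrace_traceTwo] at he
    exact he

end Trace

section Matching

variable {κ : Type} [Fintype κ] [DecidableEq κ]

/-- The product of `η`-factors over a perfect matching of the positions. -/
def matchTensor (e : κ ⊕ κ ≃ ι) : (ι → Fin 4) → ℝ :=
  fun idx => ∏ x, η (idx (e (.inl x))) (idx (e (.inr x)))

lemma matchTensor_infInv (e : κ ⊕ κ ≃ ι) : InfInv (matchTensor e) := by
  intro a b idx
  rw [← Equiv.sum_comp e, Fintype.sum_sum_type, ← Finset.sum_add_distrib]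
  refine Finset.sum_eq_zero fun x _ => ?_
  have hl : ∀ c, matchTensor e (update idx (e (.inl x)) c) =
      η c (idx (e (.inr x))) *
        ∏ y ∈ Finset.univ.erase x, η (idx (e (.inl y))) (idx (e (.inr y))) := by
    intro c
    unfold matchTensor
    rw [← Finset.mul_prod_erase _ _ (Finset.mem_univ x)]
    congr 1
    · simp
    · refine Finset.prod_congr rfl fun y hy => ?_
      have := Finset.ne_of_mem_erase hy
      simp [this]
  have hr : ∀ c, matchTensor e (update idx (e (.inr x)) c) =
      η (idx (e (.inl x))) c *
        ∏ y ∈ Finset.univ.erase x, η (idx (e (.inl y))) (idx (e (.inr y))) := by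
    intro c
    unfold matchTensor
    rw [← Finset.mul_prod_erase _ _ (Finset.mem_univ x)]
    congr 1
    · simp
    · refine Finset.prod_congr rfl fun y hy => ?_
      have := Finset.ne_of_mem_erase hy
      simp [this]
  simp only [hl, hr]
  generalize ∏ y ∈ Finset.univ.erase x, η (idx (e (.inl y))) (idx (e (.inr y))) = P
  generalize idx (e (.inl x)) = μ
  generalize idx (e (.inr x)) = ν
  have h1 : ∀ c d, η c c * (η c d * P) = if d = c then P else 0 := by
    intro c d
    by_cases h : d = c
    · subst h; rw [← mul_assoc, η_sq, one_mul, if_pos rfl]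
    · rw [η_ne (Ne.symm h), if_neg h]; ring
  have h2 : ∀ c d, η c c * (η d c * P) = if d = c then P else 0 := by
    intro c d
    by_cases h : d = c
    · subst h; rw [← mul_assoc, η_sq, one_mul, if_pos rfl]
    · rw [η_ne h, if_neg h]; ring
  simp only [h1, h2]
  split_ifs <;> ring

omit [Fintype ι] [DecidableEq ι] [DecidableEq κ] in
lemma matchTensor_elim (e : κ ⊕ κ ≃ ι) (c d : κ → Fin 4) :
    matchTensor e (Sum.elim c d ∘ e.symm) = ∏ x, η (c x) (d x) := by
  simp [matchTensor]

omit [DecidableEq ι] [DecidableEq κ] in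
lemma prod_η_elim (e : κ ⊕ κ ≃ ι) (c d : κ → Fin 4) :
    ∏ i, η ((Sum.elim c d ∘ e.symm) i) ((Sum.elim c d ∘ e.symm) i) =
      (∏ x, η (c x) (c x)) * ∏ x, η (d x) (d x) := by
  rw [← Equiv.prod_comp e, Fintype.prod_sum_type]
  simp

omit [DecidableEq κ] in
lemma prod_η_mul_self (c : κ → Fin 4) :
    (∏ x, η (c x) (c x)) * ∏ x, η (c x) (c x) = 1 := by
  rw [← Finset.prod_mul_distrib]
  exact Finset.prod_eq_one fun x _ => η_sq _

omit [DecidableEq κ] in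
lemma prod_η_ne {c d : κ → Fin 4} (h : d ≠ c) : ∏ x, η (c x) (d x) = 0 := by
  obtain ⟨x, hx⟩ := Function.ne_iff.1 h
  exact Finset.prod_eq_zero (Finset.mem_univ x) (η_ne (Ne.symm hx))

omit [Fintype ι] [DecidableEq ι] [Fintype κ] [DecidableEq κ] in
lemma exists_elim_eq (e : κ ⊕ κ ≃ ι) (idx : ι → Fin 4) :
    ∃ c d : κ → Fin 4, idx = Sum.elim c d ∘ e.symm := by
  refine ⟨fun x => idx (e (.inl x)), fun x => idx (e (.inr x)), ?_⟩
  funext i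
  obtain ⟨x, rfl⟩ := e.surjective i
  rcases x with x | x <;> simp

omit [DecidableEq ι] [DecidableEq κ] in
lemma matchTensor_parInv (e : κ ⊕ κ ≃ ι) : ParInv (matchTensor e) := by
  intro idx
  obtain ⟨c, d, rfl⟩ := exists_elim_eq e idx
  rw [prod_η_elim, matchTensor_elim]
  by_cases h : d = c
  · subst h; rw [prod_η_mul_self, one_mul]
  · rw [prod_η_ne h, mul_zero]

variable (ι) in
/-- The `η`-pairing of tensors, using that `η` is diagonal. -/
def diagPairing : ((ι → Fin 4) → ℝ) →ₗ[ℝ] ((ι → Fin 4) → ℝ) →ₗ[ℝ] ℝ :=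
  LinearMap.mk₂ ℝ (fun t s => ∑ idx : ι → Fin 4, (∏ i, η (idx i) (idx i)) * t idx * s idx)
    (fun t t' s => by simp [mul_add, add_mul, Finset.sum_add_distrib])
    (fun c t s => by
      simp only [Pi.smul_apply, smul_eq_mul, Finset.mul_sum]
      exact Finset.sum_congr rfl fun _ _ => by ring)
    (fun t s s' => by simp [mul_add, Finset.sum_add_distrib])
    (fun c t s => by
      simp only [Pi.smul_apply, smul_eq_mul, Finset.mul_sum]
      exact Finset.sum_congr rfl fun _ _ => by ring)

lemma diagPairing_matchTensor (e : κ ⊕ κ ≃ ι) (t : (ι → Fin 4) → ℝ) :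
    diagPairing ι t (matchTensor e) = fullTrace e t := by
  simp only [diagPairing, LinearMap.mk₂_apply, fullTrace]
  let E : (κ → Fin 4) × (κ → Fin 4) ≃ (ι → Fin 4) :=
    (Equiv.sumArrowEquivProdArrow κ κ (Fin 4)).symm.trans (Equiv.arrowCongr e (Equiv.refl _))
  have hE : ∀ c d, E (c, d) = Sum.elim c d ∘ e.symm := fun c d => rfl
  rw [← Equiv.sum_comp E, Fintype.sum_prod_type]
  refine Finset.sum_congr rfl fun c _ => ?_
  rw [Finset.sum_eq_single c (fun d _ hd => ?_) (by simp)]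
  · rw [hE, prod_η_elim, matchTensor_elim, prod_η_mul_self, one_mul, mul_comm]
  · rw [hE, matchTensor_elim, prod_η_ne hd, mul_zero]

end Matching

variable (ι) in
/-- The infinitesimally Lorentz invariant, parity-invariant tensors. -/
def invariants : Submodule ℝ ((ι → Fin 4) → ℝ) where
  carrier := {t | InfInv t ∧ ParInv t}
  zero_mem' := by simp [InfInv, ParInv]
  add_mem' := by
    rintro u v ⟨hu, hu'⟩ ⟨hv, hv'⟩
    refine ⟨fun a b idx => ?_, fun idx => ?_⟩
    · refine Eq.trans ?_ ((congrArg₂ (· + ·) (hu a b idx) (hv a b idx)).trans (add_zero 0))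
      simp only [← Finset.sum_add_distrib]
      refine Finset.sum_congr rfl fun i _ => ?_
      simp only [Pi.add_apply]
      split_ifs <;> ring
    · simp only [Pi.add_apply, mul_add, hu' idx, hv' idx]
  smul_mem' := by
    rintro c u ⟨hu, hu'⟩
    refine ⟨fun a b idx => ?_, fun idx => ?_⟩
    · refine Eq.trans ?_ ((congrArg (c * ·) (hu a b idx)).trans (mul_zero c))
      simp only [Finset.mul_sum]
      refine Finset.sum_congr rfl fun i _ => ?_
      simp only [Pi.smul_apply, smul_eq_mul]
      split_ifs <;> ring
    · simp only [Pi.smul_apply, smul_eq_mul]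
      linear_combination c * hu' idx

lemma exists_fullTrace_ne_zero_of_card {k : ℕ} (hk : Fintype.card ι = 2 * k)
    {t : (ι → Fin 4) → ℝ} (ht : InfInv t) (hp : ParInv t) (h0 : t ≠ 0) :
    ∃ e : Fin k ⊕ Fin k ≃ ι, fullTrace e t ≠ 0 := by
  obtain ⟨k', e, he⟩ := exists_fullTrace_ne_zero _ ι t rfl ht hp h0
  have hc := Fintype.card_congr e
  simp only [Fintype.card_sum, Fintype.card_fin] at hc
  obtain rfl : k' = k := by omega
  exact ⟨e, he⟩

/-- Invariant tensors are spanned by products of `η`-factors. -/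
lemma span_matchTensor_eq_invariants {k : ℕ} (hk : Fintype.card ι = 2 * k) :
    Submodule.span ℝ (Set.range fun e : Fin k ⊕ Fin k ≃ ι => matchTensor e) = invariants ι := by
  set S := Submodule.span ℝ (Set.range fun e : Fin k ⊕ Fin k ≃ ι => matchTensor e) with hS
  have hle : S ≤ invariants ι := by
    rw [hS, Submodule.span_le]
    rintro _ ⟨e, rfl⟩
    exact ⟨matchTensor_infInv e, matchTensor_parInv e⟩
  refine Submodule.eq_of_le_of_finrank_le hle ?_
  let φ : invariants ι →ₗ[ℝ] Module.Dual ℝ S :=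
    (diagPairing ι).compl₁₂ (invariants ι).subtype S.subtype
  have hφ : Injective φ := by
    rw [← LinearMap.ker_eq_bot, LinearMap.ker_eq_bot']
    rintro ⟨t, ht, hp⟩ hz
    by_contra h0
    have h0' : t ≠ 0 := fun h => h0 (Subtype.ext h)
    obtain ⟨e, he⟩ := exists_fullTrace_ne_zero_of_card hk ht hp h0'
    rw [← diagPairing_matchTensor] at he
    exact he (LinearMap.congr_fun hz ⟨matchTensor e, Submodule.subset_span ⟨e, rfl⟩⟩)
  exact (LinearMap.finrank_le_finrank_of_injective hφ).trans_eq Subspace.dual_finrank_eq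

section Split

variable {n k : ℕ}

/-- A splitting without remaining positions is a perfect matching. -/
def splitMatching (h : 2 * k = n) : PairSplit n k ≃ (Fin k ⊕ Fin k ≃ Fin n) :=
  haveI : IsEmpty (Fin (n - 2 * k)) := by rw [h, Nat.sub_self]; infer_instance
  Equiv.equivCongr (Equiv.sumCongr (Equiv.refl _) (Equiv.sumEmpty _ _)) (Equiv.refl _)

lemma place_const (h : 2 * k = n) (e : PairSplit n k) (r : ℝ) :
    place k e (fun _ => r) = r • matchTensor (splitMatching h e) := by
  funext idx
  simp [place, matchTensor, splitMatching, mul_comm]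

lemma ctr_eq_fullTrace (h : 2 * k = n) (e : PairSplit n k) (t : MinkTensor n) :
    ctr k e t = fun _ => fullTrace (splitMatching h e) t := by
  funext idx
  refine Finset.sum_congr rfl fun c _ => ?_
  congr 2
  funext p
  obtain ⟨x, rfl⟩ := e.surjective p
  rcases x with x | x | x
  · simp [splitMatching, Equiv.equivCongr]
  · simp [splitMatching, Equiv.equivCongr]
  · exact absurd x.2 (by omega)

lemma isInvariant_of_rank_zero (h : 2 * k = n) (s : MinkTensor (n - 2 * k)) :
    IsInvariant s := by
  have : IsEmpty (Fin (n - 2 * k)) := by rw [h, Nat.sub_self]; infer_instance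
  have : ∀ Λ, actT Λ s = s := by
    intro Λ
    funext idx
    simp only [actT, Finset.univ_eq_empty, Finset.prod_empty, one_mul, Fintype.sum_unique]
    exact congrArg s (Subsingleton.elim _ _)
  exact ⟨fun Λ _ => this Λ, this _⟩

end Split

end MinkTensors

/-!  STATEMENT 15.
Trace decomposition of invariant Minkowski tensors: a Lorentz covariant, parity invariant
tensor is a sum over pair-partitions of the index positions of `η`-factors times traceless
covariant parity-invariant tensors, which may be chosen among linear combinations of
iterated `η`-traces of `t`. -/

open MinkTensors in
theorem trace_decomposition {n : ℕ} (t : MinkTensor n) (ht : IsInvariant t) :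
    ∃ T : (k : ℕ) → (e : PairSplit n k) → MinkTensor (n - 2 * k),
      (∀ k (e : PairSplit n k),
        Traceless (T k e) ∧ IsInvariant (T k e) ∧
        T k e ∈ Submodule.span ℝ (Set.range fun e' : PairSplit n k => ctr k e' t)) ∧
      ∀ idx : Fin n → Fin 4,
        t idx = ∑ k ∈ Finset.range (n / 2 + 1), ∑ e : PairSplit n k,
          place k e (T k e) idx := by
  classical
  have hzero : ∀ k (e : PairSplit n k), Traceless (0 : MinkTensor (n - 2 * k)) ∧
      IsInvariant (0 : MinkTensor (n - 2 * k)) ∧ (0 : MinkTensor (n - 2 * k)) ∈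
        Submodule.span ℝ (Set.range fun e' : PairSplit n k => ctr k e' t) := by
    intro k e
    refine ⟨fun i j _ idx => by simp, ⟨fun Λ _ => ?_, ?_⟩, Submodule.zero_mem _⟩ <;>
    · funext idx
      simp [actT]
  by_cases h0 : t = 0
  · exact ⟨fun _ _ => 0, hzero, fun idx => by simp [h0, place]⟩
  have hspan : ∀ k, 2 * k = n → ∃ c : (Fin k ⊕ Fin k ≃ Fin n) → ℝ,
      ∑ e, c e • matchTensor e = t := by
    intro k hk
    rw [← Submodule.mem_span_range_iff_exists_fun,
      span_matchTensor_eq_invariants (by rw [Fintype.card_fin, hk])]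
    exact ⟨ht.infInv, ht.parInv⟩
  choose c hc using hspan
  refine ⟨fun k e => if h : 2 * k = n then fun _ => c k h (splitMatching h e) else 0,
    fun k e => ?_, fun idx => ?_⟩
  · beta_reduce
    split_ifs with h
    · refine ⟨fun i => absurd i.2 (by omega), isInvariant_of_rank_zero h _, ?_⟩
      obtain ⟨e', he'⟩ := exists_fullTrace_ne_zero_of_card (ι := Fin n) (k := k)
        (by rw [Fintype.card_fin, h]) ht.infInv ht.parInv h0
      have hmem : ctr k ((splitMatching h).symm e') t ∈
          Submodule.span ℝ (Set.range fun e' : PairSplit n k => ctr k e' t) :=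
        Submodule.subset_span ⟨_, rfl⟩
      convert Submodule.smul_mem _ (c k h (splitMatching h e) / fullTrace e' t) hmem using 1
      rw [ctr_eq_fullTrace h, Equiv.apply_symm_apply]
      funext _
      simp [he']
    · exact hzero k e
  · obtain ⟨k, e, -⟩ := exists_fullTrace_ne_zero _ (Fin n) t rfl ht.infInv ht.parInv h0
    have hk : 2 * k = n := by
      have := Fintype.card_congr e
      simp only [Fintype.card_sum, Fintype.card_fin] at this
      omega
    rw [Finset.sum_eq_single k (fun k' _ hk' => ?_) fun hk' => ?_]
    · simp only [dif_pos hk, place_const hk]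
      rw [(splitMatching hk).sum_comp fun e => (c k hk e • matchTensor e) idx]
      nth_rw 1 [← hc k hk]
      rw [Finset.sum_apply]
    · have h' : 2 * k' ≠ n := by omega
      simp [h', place]
    · exact absurd (Finset.mem_range.2 (by omega)) hk'
end
end
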